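/- arXiv:math/0504599 — 8 statements merged into one kernel-verified Lean document; each statement's English description precedes it below -/
import Mathlib

section
/- Let f : G → H be a weakly quadratic map between groups. Then: (1) any two cross-effect values commute, i.e. (a|b)_f·(a'|b')_f = (a'|b')_f·(a|b)_f for all a, b, a', b' ∈ G; (2) the cross-effect depends only on the classes of its arguments in the abelianization, i.e. (ac|b)_f = (a|b)_f and (a|bc)_f = (a|b)_f for every c ∈ [G,G]; hence (a|b)_f induces a well-defined ℤ-bilinear map G_ab × G_ab → H. In particular f(1) = 1 and f(a⁻¹) = f(a)⁻¹·(a|a)_f for all a ∈ G. -/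
/-- The cross-effect of a map between groups: `(a|b)_f = (f a * f b)⁻¹ * f (a*b)`. -/
def crossEff {G H : Type*} [Group G] [Group H] (f : G → H) (a b : G) : H :=
  (f a * f b)⁻¹ * f (a * b)

/-- The commutator `[a,b] = a⁻¹ * b⁻¹ * a * b`. -/
def cmt {G : Type*} [Group G] (a b : G) : G := a⁻¹ * b⁻¹ * a * b

/-- A map between groups is weakly quadratic if its cross-effect commutes with all values
of `f` and is multiplicative in each variable. -/
def IsWeaklyQuadratic {G H : Type*} [Group G] [Group H] (f : G → H) : Prop :=
  (∀ a b c : G, Commute (crossEff f a b) (f c)) ∧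
  (∀ a a' b : G, crossEff f (a * a') b = crossEff f a b * crossEff f a' b) ∧
  (∀ a b b' : G, crossEff f a (b * b') = crossEff f a b * crossEff f a b')

/-- A quadratic map: weakly quadratic with central cross-effect values. -/
def IsQuadratic {G H : Type*} [Group G] [Group H] (f : G → H) : Prop :=
  IsWeaklyQuadratic f ∧ ∀ a b : G, crossEff f a b ∈ Subgroup.center H

/-- A q-map: weakly quadratic with cross-effect values in the commutator subgroup. -/
def IsQMap {G H : Type*} [Group G] [Group H] (f : G → H) : Prop :=
  IsWeaklyQuadratic f ∧ ∀ a b : G, crossEff f a b ∈ commutator H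

theorem IsWeaklyQuadratic.commute_crossEff {G H : Type*} [Group G] [Group H] {f : G → H}
    (hf : IsWeaklyQuadratic f) (a b a' b' : G) :
    Commute (crossEff f a b) (crossEff f a' b') :=
  ((hf.1 a b a').mul_right (hf.1 a b b')).inv_right.mul_right (hf.1 a b (a' * b'))

/-- A homomorphism whose values commute with each other kills the commutator subgroup. -/
theorem MonoidHom.map_eq_one_of_mem_commutator {G H : Type*} [Group G] [Group H] (φ : G →* H)
    (hφ : ∀ x y, Commute (φ x) (φ y)) {c : G} (hc : c ∈ commutator G) : φ c = 1 := by
  have h : commutator G ≤ φ.ker := by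
    rw [commutator_def, Subgroup.commutator_le]
    intro x _ y _
    rw [MonoidHom.mem_ker, map_commutatorElement, commutatorElement_eq_one_iff_commute]
    exact hφ x y
  exact h hc

theorem IsWeaklyQuadratic.crossEff_left_eq_one {G H : Type*} [Group G] [Group H] {f : G → H}
    (hf : IsWeaklyQuadratic f) {c : G} (hc : c ∈ commutator G) (b : G) : crossEff f c b = 1 :=
  (MonoidHom.mk' (fun a => crossEff f a b) fun a a' => hf.2.1 a a' b).map_eq_one_of_mem_commutator
    (fun x y => hf.commute_crossEff x b y b) hc

theorem IsWeaklyQuadratic.crossEff_right_eq_one {G H : Type*} [Group G] [Group H] {f : G → H}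
    (hf : IsWeaklyQuadratic f) (a : G) {c : G} (hc : c ∈ commutator G) : crossEff f a c = 1 :=
  (MonoidHom.mk' (fun b => crossEff f a b) (hf.2.2 a)).map_eq_one_of_mem_commutator
    (fun x y => hf.commute_crossEff a x a y) hc

theorem IsWeaklyQuadratic.crossEff_congr {G H : Type*} [Group G] [Group H] {f : G → H}
    (hf : IsWeaklyQuadratic f) {a a' b b' : G} (ha : a⁻¹ * a' ∈ commutator G)
    (hb : b⁻¹ * b' ∈ commutator G) : crossEff f a b = crossEff f a' b' := by
  rw [← mul_inv_cancel_left a a', ← mul_inv_cancel_left b b', hf.2.1,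
    hf.crossEff_left_eq_one ha, mul_one, hf.2.2, hf.crossEff_right_eq_one a hb, mul_one]

theorem IsWeaklyQuadratic.map_one {G H : Type*} [Group G] [Group H] {f : G → H}
    (hf : IsWeaklyQuadratic f) : f 1 = 1 := by
  simpa [crossEff] using hf.crossEff_left_eq_one (one_mem _) 1

theorem IsWeaklyQuadratic.map_inv {G H : Type*} [Group G] [Group H] {f : G → H}
    (hf : IsWeaklyQuadratic f) (a : G) : f a⁻¹ = (f a)⁻¹ * crossEff f a a := by
  have h : crossEff f a a * crossEff f a a⁻¹ = 1 := by
    rw [← hf.2.2, mul_inv_cancel, hf.crossEff_right_eq_one a (one_mem _)]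
  have h' : crossEff f a a⁻¹ = (f a * f a⁻¹)⁻¹ := by
    rw [crossEff, mul_inv_cancel, hf.map_one, mul_one]
  rw [h', mul_inv_eq_one] at h
  rw [h, inv_mul_cancel_left]

theorem stmt_2 {G H : Type*} [Group G] [Group H] (f : G → H)
    (hf : IsWeaklyQuadratic f) :
    (∀ a b a' b' : G, Commute (crossEff f a b) (crossEff f a' b')) ∧
    (∀ a b : G, ∀ c ∈ commutator G,
      crossEff f (a * c) b = crossEff f a b ∧ crossEff f a (b * c) = crossEff f a b) ∧
    (∃ β : Abelianization G → Abelianization G → H,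
      (∀ a b : G, β (Abelianization.of a) (Abelianization.of b) = crossEff f a b) ∧
      (∀ x x' y : Abelianization G, β (x * x') y = β x y * β x' y) ∧
      (∀ x y y' : Abelianization G, β x (y * y') = β x y * β x y')) ∧
    f 1 = 1 ∧
    (∀ a : G, f a⁻¹ = (f a)⁻¹ * crossEff f a a) := by
  refine ⟨hf.commute_crossEff, fun a b c hc => ⟨?_, ?_⟩, ?_, hf.map_one, hf.map_inv⟩
  · rw [hf.2.1, hf.crossEff_left_eq_one hc, mul_one]
  · rw [hf.2.2, hf.crossEff_right_eq_one a hc, mul_one]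
  · let β : Abelianization G → Abelianization G → H :=
      Quotient.lift₂ (crossEff f) fun _ _ _ _ ha hb =>
        hf.crossEff_congr (QuotientGroup.leftRel_apply.mp ha) (QuotientGroup.leftRel_apply.mp hb)
    refine ⟨β, fun _ _ => rfl, ?_, ?_⟩
    · rintro ⟨a⟩ ⟨a'⟩ ⟨b⟩
      exact hf.2.1 a a' b
    · rintro ⟨a⟩ ⟨b⟩ ⟨b'⟩
      exact hf.2.2 a b b'
end

section
/- Let f : G → H be a weakly quadratic map between groups. Then: (1) for every c ∈ [G,G] and every a ∈ G one has f(a·c) = f(a)·f(c); in particular the restriction of f to the commutator subgroup [G,G] is a group homomorphism; (2) for all a, b ∈ G one has f([a,b]) = [f(a), f(b)]·(a|b)_f·((b|a)_f)⁻¹. -/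
theorem apply_mul_eq {G H : Type*} [Group G] [Group H] (f : G → H) (a b : G) :
    f (a * b) = f a * f b * crossEff f a b := by
  rw [crossEff, mul_inv_cancel_left]

namespace IsWeaklyQuadratic

variable {G H : Type*} [Group G] [Group H] {f : G → H}

theorem commute_crossEff_s3 (hf : IsWeaklyQuadratic f) (a b c d : G) :
    Commute (crossEff f a b) (crossEff f c d) :=
  ((hf.1 a b c).mul_right (hf.1 a b d)).inv_right.mul_right (hf.1 a b (c * d))

/-- The cross-effect of a weakly quadratic map vanishes when its second argument lies in the
commutator subgroup. -/
theorem crossEff_eq_one (hf : IsWeaklyQuadratic f) (a : G) {c : G} (hc : c ∈ commutator G) :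
    crossEff f a c = 1 := by
  let φ : G →* H := MonoidHom.mk' (crossEff f a) (hf.2.2 a)
  have hle : commutator G ≤ φ.ker := by
    rw [commutator_def, Subgroup.commutator_le]
    intro x _ y _
    rw [MonoidHom.mem_ker, map_commutatorElement, commutatorElement_eq_one_iff_commute]
    exact hf.commute_crossEff_s3 a x a y
  exact MonoidHom.mem_ker.mp (hle hc)

theorem apply_mul_of_mem_commutator (hf : IsWeaklyQuadratic f) (a : G) {c : G}
    (hc : c ∈ commutator G) : f (a * c) = f a * f c := by
  rw [apply_mul_eq f a c, hf.crossEff_eq_one a hc, mul_one]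

theorem apply_cmt (hf : IsWeaklyQuadratic f) (a b : G) :
    f (cmt a b) = cmt (f a) (f b) * crossEff f a b * (crossEff f b a)⁻¹ := by
  have hmem : cmt a b ∈ commutator G := by
    have h := Subgroup.commutator_mem_commutator (Subgroup.mem_top a⁻¹) (Subgroup.mem_top b⁻¹)
    simpa [commutatorElement_def, cmt, commutator_def] using h
  have h := hf.apply_mul_of_mem_commutator (b * a) hmem
  have hab : b * a * cmt a b = a * b := by simp only [cmt]; group
  rw [hab, apply_mul_eq f a b, apply_mul_eq f b a] at h
  have hcomm : Commute (crossEff f b a)⁻¹ (cmt (f a) (f b) * crossEff f a b) := by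
    have ha := hf.1 b a a
    have hb := hf.1 b a b
    exact ((((ha.inv_right.mul_right hb.inv_right).mul_right ha).mul_right hb).mul_right
      (hf.commute_crossEff_s3 b a a b)).inv_left
  rw [← hcomm.eq, eq_inv_mul_iff_mul_eq]
  apply mul_left_cancel (a := f b * f a)
  rw [← mul_assoc, ← h]
  simp only [cmt]
  group

end IsWeaklyQuadratic

theorem stmt_3 {G H : Type*} [Group G] [Group H] (f : G → H)
    (hf : IsWeaklyQuadratic f) :
    (∀ a : G, ∀ c ∈ commutator G, f (a * c) = f a * f c) ∧
    (∀ c ∈ commutator G, ∀ d ∈ commutator G, f (c * d) = f c * f d) ∧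
    (∀ a b : G, f (cmt a b) = cmt (f a) (f b) * crossEff f a b * (crossEff f b a)⁻¹) :=
  ⟨fun a _ hc => hf.apply_mul_of_mem_commutator a hc,
    fun c _ _ hd => hf.apply_mul_of_mem_commutator c hd,
    hf.apply_cmt⟩
end

section
/- Let G be a group and H a group of nilpotence class two, and let f, g : G → H be quadratic maps. Then the pointwise product f·g (defined by (f·g)(x) = f(x)·g(x)) and the pointwise inverse f⁻¹ (defined by f⁻¹(x) = f(x)⁻¹) are again quadratic maps, with cross-effects (a|b)_{f·g} = (a|b)_f·(a|b)_g·[f(b), g(a)] and (a|b)_{f⁻¹} = [f(b), f(a)]·((a|b)_f)⁻¹ for all a, b ∈ G. -/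
section Commutators

open scoped commutatorElement

variable {H : Type*} [Group H]

theorem cmt_mem_center (hH : commutator H ≤ Subgroup.center H) (x y : H) :
    cmt x y ∈ Subgroup.center H := by
  have h : ⁅x⁻¹, y⁻¹⁆ ∈ commutator H :=
    Subgroup.commutator_mem_commutator (Subgroup.mem_top _) (Subgroup.mem_top _)
  simpa [cmt, commutatorElement_def] using hH h

theorem cmt_mul_left (hH : commutator H ≤ Subgroup.center H) (x y z : H) :
    cmt (x * y) z = cmt x z * cmt y z := by
  have h := Subgroup.mem_center_iff.mp (cmt_mem_center hH x z) y⁻¹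
  calc cmt (x * y) z = y⁻¹ * cmt x z * (y * cmt y z) := by simp only [cmt]; group
    _ = cmt x z * cmt y z := by rw [h]; group

theorem cmt_inv (x y : H) : (cmt x y)⁻¹ = cmt y x := by
  simp only [cmt]; group

theorem cmt_mul_right (hH : commutator H ≤ Subgroup.center H) (x y z : H) :
    cmt x (y * z) = cmt x y * cmt x z := by
  rw [← cmt_inv, cmt_mul_left hH, mul_inv_rev, cmt_inv, cmt_inv]
  exact Subgroup.mem_center_iff.mp (cmt_mem_center hH x y) _

theorem cmt_of_mem_center_left {c : H} (hc : c ∈ Subgroup.center H) (x : H) :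
    cmt c x = 1 := by
  rw [cmt, mul_assoc, ← Subgroup.mem_center_iff.mp hc x]; group

theorem cmt_of_mem_center_right {c : H} (hc : c ∈ Subgroup.center H) (x : H) :
    cmt x c = 1 := by
  rw [← cmt_inv, cmt_of_mem_center_left hc, inv_one]

theorem cmt_inv_inv (hH : commutator H ≤ Subgroup.center H) (x y : H) :
    cmt x⁻¹ y⁻¹ = cmt x y := by
  have h := Subgroup.mem_center_iff.mp (cmt_mem_center hH x⁻¹ y⁻¹) (y * x)
  calc cmt x⁻¹ y⁻¹ = (y * x)⁻¹ * (y * x * cmt x⁻¹ y⁻¹) := by group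
    _ = cmt x y := by rw [h]; simp only [cmt]; group

end Commutators

section CrossEffects

variable {G H : Type*} [Group G] [Group H]

theorem map_mul_eq_mul_crossEff (f : G → H) (a b : G) :
    f (a * b) = f a * f b * crossEff f a b := by
  simp only [crossEff]; group

theorem cmt_map_mul_left (hH : commutator H ≤ Subgroup.center H) {f : G → H}
    (hf : IsQuadratic f) (a b : G) (z : H) :
    cmt (f (a * b)) z = cmt (f a) z * cmt (f b) z := by
  rw [map_mul_eq_mul_crossEff f, cmt_mul_left hH, cmt_mul_left hH,
    cmt_of_mem_center_left (hf.2 a b), mul_one]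

theorem cmt_map_mul_right (hH : commutator H ≤ Subgroup.center H) {f : G → H}
    (hf : IsQuadratic f) (a b : G) (z : H) :
    cmt z (f (a * b)) = cmt z (f a) * cmt z (f b) := by
  rw [map_mul_eq_mul_crossEff f, cmt_mul_right hH, cmt_mul_right hH,
    cmt_of_mem_center_right (hf.2 a b), mul_one]

theorem mul_mul_mul_comm_of_mem_center {q : H} (hq : q ∈ Subgroup.center H) (p r s : H) :
    p * r * (q * s) = p * q * (r * s) := by
  have h := Subgroup.mem_center_iff.mp hq r
  rw [mul_assoc p r, ← mul_assoc r, h, mul_assoc q, mul_assoc]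

theorem IsQuadratic.of_mem_center {f : G → H}
    (hc : ∀ a b, crossEff f a b ∈ Subgroup.center H)
    (hl : ∀ a a' b, crossEff f (a * a') b = crossEff f a b * crossEff f a' b)
    (hr : ∀ a b b', crossEff f a (b * b') = crossEff f a b * crossEff f a b') :
    IsQuadratic f :=
  ⟨⟨fun a b c => (Subgroup.mem_center_iff.mp (hc a b) (f c)).symm, hl, hr⟩, hc⟩

theorem crossEff_mul (hH : commutator H ≤ Subgroup.center H) {f g : G → H}
    (hf : IsQuadratic f) (hg : IsQuadratic g) (a b : G) :
    crossEff (fun x => f x * g x) a b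
      = crossEff f a b * crossEff g a b * cmt (f b) (g a) := by
  have h₁ := Subgroup.mem_center_iff.mp (hf.2 a b) (g a * g b)
  have h₂ := Subgroup.mem_center_iff.mp (mul_mem (hf.2 a b) (hg.2 a b))
    ((g b)⁻¹ * cmt (f b) (g a) * g b)
  have h₃ := Subgroup.mem_center_iff.mp (cmt_mem_center hH (f b) (g a)) (g b)⁻¹
  calc crossEff (fun x => f x * g x) a b
      = (f a * g a * (f b * g b))⁻¹ * (f a * f b) *
          (crossEff f a b * (g a * g b)) * crossEff g a b := by
        simp only [crossEff]; group
    _ = (g b)⁻¹ * cmt (f b) (g a) * g b * (crossEff f a b * crossEff g a b) := by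
        rw [← h₁]; simp only [cmt]; group
    _ = crossEff f a b * crossEff g a b * cmt (f b) (g a) := by
        rw [h₂, h₃, inv_mul_cancel_right]

theorem crossEff_inv (hH : commutator H ≤ Subgroup.center H) {f : G → H}
    (hf : IsQuadratic f) (a b : G) :
    crossEff (fun x => (f x)⁻¹) a b = cmt (f b) (f a) * (crossEff f a b)⁻¹ := by
  have h := Subgroup.mem_center_iff.mp (inv_mem (hf.2 a b)) ((f b)⁻¹ * (f a)⁻¹)
  calc crossEff (fun x => (f x)⁻¹) a b
      = f b * f a * ((crossEff f a b)⁻¹ * ((f b)⁻¹ * (f a)⁻¹)) := by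
        simp only [crossEff]; group
    _ = cmt (f b)⁻¹ (f a)⁻¹ * (crossEff f a b)⁻¹ := by
        rw [← h]; simp only [cmt]; group
    _ = cmt (f b) (f a) * (crossEff f a b)⁻¹ := by rw [cmt_inv_inv hH]

theorem IsQuadratic.mul (hH : commutator H ≤ Subgroup.center H) {f g : G → H}
    (hf : IsQuadratic f) (hg : IsQuadratic g) : IsQuadratic (fun x => f x * g x) := by
  refine .of_mem_center (fun a b => ?_) (fun a a' b => ?_) (fun a b b' => ?_)
  · rw [crossEff_mul hH hf hg]
    exact mul_mem (mul_mem (hf.2 a b) (hg.2 a b)) (cmt_mem_center hH _ _)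
  · simp only [crossEff_mul hH hf hg]
    rw [hf.1.2.1, hg.1.2.1, cmt_map_mul_right hH hg,
      mul_mul_mul_comm_of_mem_center (hg.2 a b),
      mul_mul_mul_comm_of_mem_center (cmt_mem_center hH (f b) (g a))]
  · simp only [crossEff_mul hH hf hg]
    rw [hf.1.2.2, hg.1.2.2, cmt_map_mul_left hH hf,
      mul_mul_mul_comm_of_mem_center (hg.2 a b),
      mul_mul_mul_comm_of_mem_center (cmt_mem_center hH (f b) (g a))]

theorem IsQuadratic.inv (hH : commutator H ≤ Subgroup.center H) {f : G → H}
    (hf : IsQuadratic f) : IsQuadratic (fun x => (f x)⁻¹) := by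
  refine .of_mem_center (fun a b => ?_) (fun a a' b => ?_) (fun a b b' => ?_)
  · rw [crossEff_inv hH hf]
    exact mul_mem (cmt_mem_center hH _ _) (inv_mem (hf.2 a b))
  · simp only [crossEff_inv hH hf]
    rw [hf.1.2.1, cmt_map_mul_right hH hf, mul_inv_rev,
      Subgroup.mem_center_iff.mp (inv_mem (hf.2 a b)),
      mul_mul_mul_comm_of_mem_center (inv_mem (hf.2 a b))]
  · simp only [crossEff_inv hH hf]
    rw [hf.1.2.2, cmt_map_mul_left hH hf, mul_inv_rev,
      Subgroup.mem_center_iff.mp (inv_mem (hf.2 a b)),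
      mul_mul_mul_comm_of_mem_center (inv_mem (hf.2 a b))]

end CrossEffects

theorem stmt_5 {G H : Type*} [Group G] [Group H]
    (hH : commutator H ≤ Subgroup.center H)
    (f g : G → H) (hf : IsQuadratic f) (hg : IsQuadratic g) :
    IsQuadratic (fun x => f x * g x) ∧
    IsQuadratic (fun x => (f x)⁻¹) ∧
    (∀ a b : G, crossEff (fun x => f x * g x) a b
      = crossEff f a b * crossEff g a b * cmt (f b) (g a)) ∧
    (∀ a b : G, crossEff (fun x => (f x)⁻¹) a b
      = cmt (f b) (f a) * (crossEff f a b)⁻¹) :=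
  ⟨hf.mul hH hg, hf.inv hH, crossEff_mul hH hf hg, crossEff_inv hH hf⟩
end

section
/- Let G be a group of nilpotence class two. For a ∈ G and b ∈ Z(G), the map f_{a,b} : ℤ → G given by f_{a,b}(n) = aⁿ·b^{n(n−1)/2} is a quadratic map with cross-effect (n|m)_{f_{a,b}} = b^{n·m} for all integers n, m. Conversely, every quadratic map f : ℤ → G is of this form: f = f_{a,b} with a = f(1) and b = (1|1)_f. Moreover the pointwise product satisfies f_{a,b}·f_{a',b'} = f_{a·a',\,b·b'·[a,a']}. -/
/-- Cross-effect for maps from the additive group `ℤ` to a (multiplicative) group: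
`(n|m)_f = (f n * f m)⁻¹ * f (n + m)`. -/
def crossEffZ {G : Type*} [Group G] (f : ℤ → G) (n m : ℤ) : G :=
  (f n * f m)⁻¹ * f (n + m)

/-- Quadratic maps from `ℤ` to a group. -/
def IsQuadraticZ {G : Type*} [Group G] (f : ℤ → G) : Prop :=
  (∀ n m k : ℤ, Commute (crossEffZ f n m) (f k)) ∧
  (∀ n n' m : ℤ, crossEffZ f (n + n') m = crossEffZ f n m * crossEffZ f n' m) ∧
  (∀ n m m' : ℤ, crossEffZ f n (m + m') = crossEffZ f n m * crossEffZ f n m') ∧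
  (∀ n m : ℤ, crossEffZ f n m ∈ Subgroup.center G)

/-- The map `f_{a,b} : ℤ → G`, `n ↦ aⁿ · b^{n(n-1)/2}`. -/
def fab {G : Type*} [Group G] (a b : G) (n : ℤ) : G :=
  a ^ n * b ^ (n * (n - 1) / 2)

theorem Int.add_mul_pred_ediv_two (n m : ℤ) :
    (n + m) * (n + m - 1) / 2 = n * (n - 1) / 2 + m * (m - 1) / 2 + n * m := by
  obtain ⟨k, hk⟩ := Int.even_mul_pred_self n
  obtain ⟨l, hl⟩ := Int.even_mul_pred_self m
  have h : (n + m) * (n + m - 1) = n * (n - 1) + m * (m - 1) + 2 * (n * m) := by ring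
  omega

theorem fab_zero {G : Type*} [Group G] (a b : G) : fab a b 0 = 1 := by simp [fab]

theorem fab_one {G : Type*} [Group G] (a b : G) : fab a b 1 = a := by simp [fab]

theorem fab_add {G : Type*} [Group G] (a : G) {b : G} (hb : b ∈ Subgroup.center G) (n m : ℤ) :
    fab a b (n + m) = fab a b n * fab a b m * b ^ (n * m) := by
  have h : b ^ (n * (n - 1) / 2) * a ^ m = a ^ m * b ^ (n * (n - 1) / 2) :=
    (Subgroup.mem_center_iff.mp (zpow_mem hb _) _).symm
  simp only [fab, Int.add_mul_pred_ediv_two, zpow_add, mul_assoc]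
  rw [← mul_assoc (b ^ _) (a ^ m), h]
  simp only [mul_assoc]

theorem crossEffZ_fab {G : Type*} [Group G] (a : G) {b : G} (hb : b ∈ Subgroup.center G)
    (n m : ℤ) : crossEffZ (fab a b) n m = b ^ (n * m) := by
  rw [crossEffZ, fab_add a hb, inv_mul_cancel_left]

theorem isQuadraticZ_fab {G : Type*} [Group G] (a : G) {b : G} (hb : b ∈ Subgroup.center G) :
    IsQuadraticZ (fab a b) := by
  simp only [IsQuadraticZ, crossEffZ_fab a hb]
  exact ⟨fun n m k => (Subgroup.mem_center_iff.mp (zpow_mem hb _) _).symm,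
    fun n n' m => by rw [add_mul, zpow_add], fun n m m' => by rw [mul_add, zpow_add],
    fun n m => zpow_mem hb _⟩

/-- The recursion `f (n + 1) = f n * a * b ^ n` with `f 0 = 1` characterizes `fab a b`. -/
theorem eq_fab_of_recursion {G : Type*} [Group G] {f : ℤ → G} {a b : G}
    (hb : b ∈ Subgroup.center G) (h0 : f 0 = 1) (hf : ∀ n, f (n + 1) = f n * a * b ^ n) :
    f = fab a b := by
  have hs (n : ℤ) : fab a b (n + 1) = fab a b n * a * b ^ n := by
    rw [fab_add a hb, fab_one, mul_one]
  funext n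
  induction n using Int.induction_on with
  | zero => rw [h0, fab_zero]
  | succ n ih => rw [hf, hs, ih]
  | pred n ih =>
    have h₁ := hf (-n - 1)
    have h₂ := hs (-n - 1)
    rw [sub_add_cancel] at h₁ h₂
    rw [h₁, h₂] at ih
    exact mul_right_cancel (mul_right_cancel ih)

theorem IsQuadraticZ.eq_fab {G : Type*} [Group G] {f : ℤ → G} (hf : IsQuadraticZ f) :
    f = fab (f 1) (crossEffZ f 1 1) := by
  obtain ⟨-, hl, -, hc⟩ := hf
  let φ : Multiplicative ℤ →* G :=
    MonoidHom.mk' (fun n => crossEffZ f n.toAdd 1) fun n n' => hl _ _ _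
  have hφ (n : ℤ) : crossEffZ f n 1 = crossEffZ f 1 1 ^ n := by
    simpa [φ, ← ofAdd_zsmul] using map_zpow φ (Multiplicative.ofAdd 1) n
  refine eq_fab_of_recursion (hc 1 1) ?_ fun n => ?_
  · have h : (f 1)⁻¹ * (f 0)⁻¹ * f 1 = 1 := by simpa [crossEffZ] using hφ 0
    simpa [mul_assoc, inv_mul_eq_one] using h
  · rw [← hφ, crossEffZ, mul_inv_cancel_left]

theorem cmt_mem_commutator {G : Type*} [Group G] (a b : G) : cmt a b ∈ commutator G := by
  have h := Subgroup.commutator_mem_commutator (Subgroup.mem_top a⁻¹) (Subgroup.mem_top b⁻¹)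
  simpa [commutatorElement_def, cmt, commutator_def] using h

theorem mul_zpow_eq_zpow_mul_mul_cmt_zpow {G : Type*} [Group G] {a b : G}
    (h : cmt a b ∈ Subgroup.center G) (n : ℤ) : a * b ^ n = b ^ n * a * cmt a b ^ n := by
  have hc (x : G) : Commute x (cmt a b) := Subgroup.mem_center_iff.mp h x
  have hab : a * b * a⁻¹ = b * cmt a b := by
    rw [← mul_inv_eq_iff_eq_mul.mpr (hc a).eq]
    simp [cmt, mul_assoc]
  calc a * b ^ n = (a * b * a⁻¹) ^ n * a := by rw [conj_zpow, inv_mul_cancel_right]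
    _ = b ^ n * a * cmt a b ^ n := by
      rw [hab, (hc b).mul_zpow, mul_assoc, mul_assoc, ((hc a).zpow_right n).eq]

theorem fab_mul_fab {G : Type*} [Group G] {a a' b b' : G} (hb : b ∈ Subgroup.center G)
    (hb' : b' ∈ Subgroup.center G) (h : cmt a a' ∈ Subgroup.center G) :
    (fun n => fab a b n * fab a' b' n) = fab (a * a') (b * b' * cmt a a') := by
  refine eq_fab_of_recursion (mul_mem (mul_mem hb hb') h) (by simp [fab_zero]) fun n => ?_
  have hB (k : ℤ) (x : G) : b ^ k * x = x * b ^ k :=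
    (Subgroup.mem_center_iff.mp (zpow_mem hb k) x).symm
  have hB' (k : ℤ) (x : G) : b' ^ k * x = x * b' ^ k :=
    (Subgroup.mem_center_iff.mp (zpow_mem hb' k) x).symm
  have hC (x : G) : cmt a a' ^ n * x = x * cmt a a' ^ n :=
    (Subgroup.mem_center_iff.mp (zpow_mem h n) x).symm
  have hBB' : Commute b b' := (Subgroup.mem_center_iff.mp hb b').symm
  have hBC : Commute (b * b') (cmt a a') := Subgroup.mem_center_iff.mp h _
  have key : a * fab a' b' n = fab a' b' n * a * cmt a a' ^ n := by
    rw [fab, ← mul_assoc, mul_zpow_eq_zpow_mul_mul_cmt_zpow h, mul_assoc (_ * a), hC,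
      mul_assoc (a' ^ n), ← mul_assoc a, ← hB' _ a]
    simp only [mul_assoc]
  rw [hBC.mul_zpow, hBB'.mul_zpow]
  simp only [fab_add _ hb, fab_add _ hb', fab_one, mul_one]
  calc fab a b n * a * b ^ n * (fab a' b' n * a' * b' ^ n)
      = fab a b n * (a * fab a' b' n) * a' * (b ^ n * b' ^ n) := by
        rw [mul_assoc _ (b ^ n), hB, ← hB' n (b ^ n), ← mul_assoc]
        simp only [mul_assoc]
    _ = fab a b n * fab a' b' n * (a * a') * (b ^ n * b' ^ n * cmt a a' ^ n) := by
        rw [key, ← hC (b ^ n * b' ^ n)]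
        simp only [mul_assoc]
        rw [← mul_assoc (cmt a a' ^ n) a', hC a', mul_assoc]

theorem stmt_6 {G : Type*} [Group G] (hG : commutator G ≤ Subgroup.center G) :
    (∀ (a : G), ∀ b ∈ Subgroup.center G,
      IsQuadraticZ (fab a b) ∧ (∀ n m : ℤ, crossEffZ (fab a b) n m = b ^ (n * m))) ∧
    (∀ f : ℤ → G, IsQuadraticZ f → f = fab (f 1) (crossEffZ f 1 1)) ∧
    (∀ a a' b b' : G, b ∈ Subgroup.center G → b' ∈ Subgroup.center G →
      (fun n => fab a b n * fab a' b' n) = fab (a * a') (b * b' * cmt a a')) :=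
  ⟨fun a _ hb => ⟨isQuadraticZ_fab a hb, crossEffZ_fab a hb⟩, fun _ hf => hf.eq_fab,
    fun a a' _ _ hb hb' => fab_mul_fab hb hb' (hG (cmt_mem_commutator a a'))⟩
end

section
/- Let G and H be groups of nilpotence class two, and suppose there exist q-maps f : G → H and g : H → G with g∘f = id_G and f∘g = id_H (i.e. G and H are isomorphic as objects of the category Niq of nil₂-groups and q-maps). If G is abelian, then H is abelian. -/
theorem stmt_13 {G H : Type*} [Group G] [Group H]
    (hG : commutator G ≤ Subgroup.center G) (hH : commutator H ≤ Subgroup.center H)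
    (f : G → H) (g : H → G) (hf : IsQMap f) (hg : IsQMap g)
    (hgf : g ∘ f = id) (hfg : f ∘ g = id)
    (hGab : ∀ a b : G, a * b = b * a) :
    ∀ a b : H, a * b = b * a := by
  have hcomm : commutator G = ⊥ :=
    Subgroup.commutator_eq_bot_iff_le_centralizer.mpr fun a _ =>
      Subgroup.mem_centralizer_iff.mpr fun b _ => hGab b a
  have hmul (a b : H) : g (a * b) = g a * g b := by
    have h := hg.2 a b
    rw [hcomm, Subgroup.mem_bot] at h
    exact (inv_mul_eq_one.mp h).symm
  have hinj : Function.Injective g :=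
    Function.LeftInverse.injective (g := f) (congrFun hfg)
  intro a b
  apply hinj
  rw [hmul, hmul, hGab]
end

section
/- The quaternion group Q₈ of order 8 is q-split: the quotient map Q₈ → Q₈_ab (whose target is isomorphic to ℤ/2ℤ × ℤ/2ℤ) admits a quadratic section. Explicitly, with generators ω, τ of Q₈ (ω, τ of order 4, τ² = ω² and τωτ⁻¹ = ω⁻¹), the map s sending the four elements 0, ω̂, τ̂, ω̂+τ̂ of Q₈_ab to 1, ω, τ, ωτ respectively is a quadratic section. -/
namespace QuaternionGroup

/-- The representative among `1, ω, τ, ωτ` of the class of an element of `Q₈` modulo `±1`. -/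
def abelianizationRep : QuaternionGroup 2 → QuaternionGroup 2
  | a i => if i = 0 ∨ i = 2 then 1 else a 1
  | xa i => if i = 0 ∨ i = 2 then xa 0 else a 1 * xa 0

theorem abelianizationRep_eq_of_inv_mul_mem_center :
    ∀ x y : QuaternionGroup 2, (∀ z, z * (x⁻¹ * y) = (x⁻¹ * y) * z) →
      abelianizationRep x = abelianizationRep y := by
  decide

theorem commutator_le_center : commutator (QuaternionGroup 2) ≤ Subgroup.center _ := by
  have h : ∀ x y z : QuaternionGroup 2, z * (x * y * x⁻¹ * y⁻¹) = (x * y * x⁻¹ * y⁻¹) * z := by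
    decide
  exact Subgroup.commutator_le.2 fun x _ y _ => Subgroup.mem_center_iff.2 (h x y)

/-- The section `Q₈_ab → Q₈` with values `1, ω, τ, ωτ`. -/
def abelianizationSection : Abelianization (QuaternionGroup 2) → QuaternionGroup 2 :=
  Quotient.lift abelianizationRep fun x y h =>
    abelianizationRep_eq_of_inv_mul_mem_center x y <|
      Subgroup.mem_center_iff.1 (commutator_le_center (QuotientGroup.leftRel_apply.1 h))

theorem abelianizationSection_of (x : QuaternionGroup 2) :
    abelianizationSection (Abelianization.of x) = abelianizationRep x :=
  rfl

theorem of_abelianizationRep (x : QuaternionGroup 2) :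
    Abelianization.of (abelianizationRep x) = Abelianization.of x := by
  have h : ∀ x : QuaternionGroup 2, ∃ g h, abelianizationRep x = x * (g * h * g⁻¹ * h⁻¹) := by
    decide
  obtain ⟨g, k, hx⟩ := h x
  rw [hx]
  simp only [map_mul, map_inv]
  rw [mul_comm (Abelianization.of g)]
  simp

/-- The cross-effect of `abelianizationSection`, computed on representatives. -/
theorem crossEff_abelianizationSection (x y : QuaternionGroup 2) :
    crossEff abelianizationSection (Abelianization.of x) (Abelianization.of y) =
      crossEff abelianizationRep x y :=
  rfl

theorem crossEff_abelianizationRep_central :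
    ∀ x y z : QuaternionGroup 2,
      z * crossEff abelianizationRep x y = crossEff abelianizationRep x y * z := by
  unfold crossEff
  decide

theorem crossEff_abelianizationRep_mul_left :
    ∀ x x' y : QuaternionGroup 2, crossEff abelianizationRep (x * x') y =
      crossEff abelianizationRep x y * crossEff abelianizationRep x' y := by
  unfold crossEff
  decide

theorem crossEff_abelianizationRep_mul_right :
    ∀ x y y' : QuaternionGroup 2, crossEff abelianizationRep x (y * y') =
      crossEff abelianizationRep x y * crossEff abelianizationRep x y' := by
  unfold crossEff
  decide

theorem crossEff_abelianizationSection_mem_center (x y : Abelianization (QuaternionGroup 2)) :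
    crossEff abelianizationSection x y ∈ Subgroup.center (QuaternionGroup 2) := by
  obtain ⟨x, rfl⟩ := QuotientGroup.mk_surjective x
  obtain ⟨y, rfl⟩ := QuotientGroup.mk_surjective y
  exact Subgroup.mem_center_iff.2 (crossEff_abelianizationRep_central x y)

theorem isQuadratic_abelianizationSection : IsQuadratic abelianizationSection := by
  refine ⟨⟨fun x y z => ?_, fun x x' y => ?_, fun x y y' => ?_⟩,
    crossEff_abelianizationSection_mem_center⟩
  · exact (Subgroup.mem_center_iff.1 (crossEff_abelianizationSection_mem_center x y) _).symm
  · obtain ⟨x, rfl⟩ := QuotientGroup.mk_surjective x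
    obtain ⟨x', rfl⟩ := QuotientGroup.mk_surjective x'
    obtain ⟨y, rfl⟩ := QuotientGroup.mk_surjective y
    exact crossEff_abelianizationRep_mul_left x x' y
  · obtain ⟨x, rfl⟩ := QuotientGroup.mk_surjective x
    obtain ⟨y, rfl⟩ := QuotientGroup.mk_surjective y
    obtain ⟨y', rfl⟩ := QuotientGroup.mk_surjective y'
    exact crossEff_abelianizationRep_mul_right x y y'

end QuaternionGroup

/-- The quaternion group `Q₈` is q-split, with the explicit quadratic section sending
`1, ω̂, τ̂, ω̂τ̂` to `1, ω, τ, ωτ` (here `ω = a 1`, `τ = xa 0`). -/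
theorem stmt_15 :
    ∃ s : Abelianization (QuaternionGroup 2) → QuaternionGroup 2,
      IsQuadratic s ∧
      (∀ x : Abelianization (QuaternionGroup 2), Abelianization.of (s x) = x) ∧
      s 1 = 1 ∧
      s (Abelianization.of (QuaternionGroup.a 1)) = QuaternionGroup.a 1 ∧
      s (Abelianization.of (QuaternionGroup.xa 0)) = QuaternionGroup.xa 0 ∧
      s (Abelianization.of (QuaternionGroup.a 1) * Abelianization.of (QuaternionGroup.xa 0))
        = QuaternionGroup.a 1 * QuaternionGroup.xa 0 := by
  refine ⟨QuaternionGroup.abelianizationSection,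
    QuaternionGroup.isQuadratic_abelianizationSection, fun x => ?_, ?_, ?_, ?_, ?_⟩
  · obtain ⟨x, rfl⟩ := QuotientGroup.mk_surjective x
    exact QuaternionGroup.of_abelianizationRep x
  · rw [← map_one Abelianization.of, QuaternionGroup.abelianizationSection_of]
    decide
  · rw [QuaternionGroup.abelianizationSection_of]
    decide
  · rw [QuaternionGroup.abelianizationSection_of]
    decide
  · rw [← map_mul, QuaternionGroup.abelianizationSection_of]
    decide
end

section
/- The dihedral group D₄ of order 8 and the quaternion group Q₈ of order 8 are isomorphic in the category Niq: there exist q-maps f : D₄ → Q₈ and g : Q₈ → D₄ with g∘f = id and f∘g = id (although D₄ and Q₈ are not isomorphic as groups). -/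
/-- The bijection from the dihedral group of order `4n` to the generalised quaternion group of
order `4n` that matches the standard normal forms. -/
def DihedralGroup.toQuaternionGroup {n : ℕ} : DihedralGroup (2 * n) → QuaternionGroup n
  | .r i => .a i
  | .sr i => .xa i

/-- The inverse of `DihedralGroup.toQuaternionGroup`. -/
def QuaternionGroup.toDihedralGroup {n : ℕ} : QuaternionGroup n → DihedralGroup (2 * n)
  | .a i => .r i
  | .xa i => .sr i

open DihedralGroup QuaternionGroup
open scoped commutatorElement

theorem toDihedralGroup_comp_toQuaternionGroup (n : ℕ) :
    (toDihedralGroup ∘ toQuaternionGroup : DihedralGroup (2 * n) → _) = id := by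
  funext x
  cases x <;> rfl

theorem toQuaternionGroup_comp_toDihedralGroup (n : ℕ) :
    (toQuaternionGroup ∘ toDihedralGroup : QuaternionGroup n → _) = id := by
  funext x
  cases x <;> rfl

theorem isWeaklyQuadratic_toQuaternionGroup :
    IsWeaklyQuadratic (toQuaternionGroup : DihedralGroup (2 * 2) → QuaternionGroup 2) := by
  unfold IsWeaklyQuadratic Commute SemiconjBy
  decide

theorem isWeaklyQuadratic_toDihedralGroup :
    IsWeaklyQuadratic (toDihedralGroup : QuaternionGroup 2 → DihedralGroup (2 * 2)) := by
  unfold IsWeaklyQuadratic Commute SemiconjBy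
  decide

theorem mem_commutator_of_eq_one_or_eq {G : Type*} [Group G] {x : G} (g h : G)
    (hx : x = 1 ∨ x = ⁅g, h⁆) : x ∈ commutator G := by
  rcases hx with rfl | rfl
  · exact one_mem _
  · exact Subgroup.commutator_mem_commutator (Subgroup.mem_top g) (Subgroup.mem_top h)

theorem isQMap_toQuaternionGroup :
    IsQMap (toQuaternionGroup : DihedralGroup (2 * 2) → QuaternionGroup 2) := by
  refine ⟨isWeaklyQuadratic_toQuaternionGroup, fun x y ↦
    mem_commutator_of_eq_one_or_eq (.a 1) (.xa 0) ?_⟩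
  revert x y
  decide

theorem isQMap_toDihedralGroup :
    IsQMap (toDihedralGroup : QuaternionGroup 2 → DihedralGroup (2 * 2)) := by
  refine ⟨isWeaklyQuadratic_toDihedralGroup, fun x y ↦
    mem_commutator_of_eq_one_or_eq (.r 1) (.sr 0) ?_⟩
  revert x y
  decide

theorem QuaternionGroup.commute_of_mul_self_eq_one :
    ∀ x : QuaternionGroup 2, x * x = 1 → ∀ y, x * y = y * x := by
  decide

theorem isEmpty_dihedralGroup_mulEquiv_quaternionGroup :
    IsEmpty (DihedralGroup 4 ≃* QuaternionGroup 2) := by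
  refine ⟨fun e ↦ ?_⟩
  have h := commute_of_mul_self_eq_one (e (sr 0)) (by rw [← map_mul, sr_mul_self, map_one])
    (e (r 1))
  rw [← map_mul, ← map_mul, e.apply_eq_iff_eq] at h
  exact absurd h (by decide)

/-- The dihedral group `D₄` of order 8 and the quaternion group `Q₈` are isomorphic in
the category `Niq` of nil₂-groups and q-maps, although not isomorphic as groups. -/
theorem stmt_16 :
    (∃ (f : DihedralGroup 4 → QuaternionGroup 2) (g : QuaternionGroup 2 → DihedralGroup 4),
      IsQMap f ∧ IsQMap g ∧ g ∘ f = id ∧ f ∘ g = id) ∧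
    IsEmpty (DihedralGroup 4 ≃* QuaternionGroup 2) := by
  exact ⟨⟨toQuaternionGroup (n := 2), toDihedralGroup (n := 2), isQMap_toQuaternionGroup,
    isQMap_toDihedralGroup,
    toDihedralGroup_comp_toQuaternionGroup 2, toQuaternionGroup_comp_toDihedralGroup 2⟩,
    isEmpty_dihedralGroup_mulEquiv_quaternionGroup⟩
end

section
/- Let R be a commutative ring in which 2 is invertible, and let L and L' be Lie algebras over R satisfying [L,[L,L]] = 0 and [L',[L',L']] = 0. A map f : L → L' is a Lie q-map if and only if there exist an additive map g : L → L' with g([L,L]) ⊆ [L',L'] and a symmetric ℤ-bilinear map h : L × L → [L',L'] satisfying h(a+c, b) = h(a, b) for all c ∈ [L,L] (so h factors through the abelianization L/[L,L] in each variable), such that f(a) = g(a) + (1/2)·h(a,a) for all a ∈ L. Here [L,L] denotes the Lie ideal generated by all brackets. -/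
/-- The additive cross-effect `(a|b)_f = f(a+b) - f(a) - f(b)` of a map between
additive groups. -/
def lieCrossEff {L L' : Type*} [AddGroup L] [AddGroup L'] (f : L → L') (a b : L) : L' :=
  f (a + b) - f a - f b

/-- A Lie q-map between Lie algebras: a quadratic map of underlying abelian groups whose
cross-effect takes values in `[L',L']`, which is additive with respect to elements of
`[L,L]` and maps `[L,L]` into `[L',L']`. -/
def IsLieQMap (R : Type*) {L L' : Type*} [CommRing R]
    [LieRing L] [LieAlgebra R L] [LieRing L'] [LieAlgebra R L'] (f : L → L') : Prop :=
  (∀ a a' b : L, lieCrossEff f (a + a') b = lieCrossEff f a b + lieCrossEff f a' b) ∧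
  (∀ a b b' : L, lieCrossEff f a (b + b') = lieCrossEff f a b + lieCrossEff f a b') ∧
  (∀ a b : L, lieCrossEff f a b ∈ ⁅(⊤ : LieIdeal R L'), (⊤ : LieIdeal R L')⁆) ∧
  (∀ a : L, ∀ c ∈ ⁅(⊤ : LieIdeal R L), (⊤ : LieIdeal R L)⁆, f (a + c) = f a + f c) ∧
  (∀ c ∈ ⁅(⊤ : LieIdeal R L), (⊤ : LieIdeal R L)⁆,
    f c ∈ ⁅(⊤ : LieIdeal R L'), (⊤ : LieIdeal R L')⁆)

theorem lieCrossEff_comm {L L' : Type*} [AddCommGroup L] [AddCommGroup L'] (f : L → L')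
    (a b : L) : lieCrossEff f a b = lieCrossEff f b a := by
  unfold lieCrossEff
  rw [add_comm a b]
  abel

theorem biadditive_diagonal_add {L L' : Type*} (R : Type*) [Semiring R] [AddCommMonoid L]
    [AddCommMonoid L'] [Module R L'] (h : L → L → L') (h_symm : ∀ a b : L, h a b = h b a)
    (h_add : ∀ a a' b : L, h (a + a') b = h a b + h a' b) (a b : L) :
    h (a + b) (a + b) = h a a + h b b + (2 : R) • h a b := by
  rw [h_add, h_symm a (a + b), h_symm b (a + b), h_add, h_add, h_symm b a, two_smul]
  abel

/-- The cross-effect of the sum of an additive map and half the diagonal of a symmetric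
biadditive map is that biadditive map. -/
theorem lieCrossEff_add_half_diagonal {R L L' : Type*} [CommRing R] [Invertible (2 : R)]
    [AddCommGroup L] [AddCommGroup L'] [Module R L'] (f : L → L') (g : L →+ L')
    (h : L → L → L') (h_symm : ∀ a b : L, h a b = h b a)
    (h_add : ∀ a a' b : L, h (a + a') b = h a b + h a' b)
    (hf : ∀ a : L, f a = g a + (⅟(2 : R)) • h a a) (a b : L) :
    lieCrossEff f a b = h a b := by
  rw [lieCrossEff, hf, hf, hf, biadditive_diagonal_add R h h_symm h_add, map_add, smul_add,
    smul_add, invOf_smul_smul]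
  abel

/-- A map between class two nilpotent Lie algebras over a ring where 2 is invertible is a
Lie q-map iff it is of the form `f(a) = g(a) + ½·h(a,a)` with `g` additive preserving
commutator ideals and `h` symmetric bilinear, with values in `[L',L']`, factoring through
the abelianization in each variable. -/
theorem stmt_19 {R L L' : Type*} [CommRing R] [Invertible (2 : R)]
    [LieRing L] [LieAlgebra R L] [LieRing L'] [LieAlgebra R L']
    (hL : ∀ a b c : L, ⁅a, ⁅b, c⁆⁆ = 0) (hL' : ∀ a b c : L', ⁅a, ⁅b, c⁆⁆ = 0)
    (f : L → L') :
    IsLieQMap R f ↔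
      ∃ (g : L →+ L') (h : L → L → L'),
        (∀ c ∈ ⁅(⊤ : LieIdeal R L), (⊤ : LieIdeal R L)⁆,
          g c ∈ ⁅(⊤ : LieIdeal R L'), (⊤ : LieIdeal R L')⁆) ∧
        (∀ a b : L, h a b = h b a) ∧
        (∀ a a' b : L, h (a + a') b = h a b + h a' b) ∧
        (∀ a b : L, h a b ∈ ⁅(⊤ : LieIdeal R L'), (⊤ : LieIdeal R L')⁆) ∧
        (∀ a b : L, ∀ c ∈ ⁅(⊤ : LieIdeal R L), (⊤ : LieIdeal R L)⁆, h (a + c) b = h a b) ∧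
        (∀ a : L, f a = g a + (⅟(2 : R)) • h a a) := by
  constructor
  · rintro ⟨add_left, -, mem, add_comm_right, map_mem⟩
    have diag := biadditive_diagonal_add R (lieCrossEff f) (lieCrossEff_comm f) add_left
    refine ⟨AddMonoidHom.mk' (fun a ↦ f a - (⅟(2 : R)) • lieCrossEff f a a) ?_,
      lieCrossEff f, ?_, lieCrossEff_comm f, add_left, mem, ?_, ?_⟩
    · intro a b
      have hab : f (a + b) = f a + f b + lieCrossEff f a b := by
        unfold lieCrossEff
        abel
      rw [diag, hab, smul_add, smul_add, invOf_smul_smul]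
      abel
    · intro c hc
      exact sub_mem (map_mem c hc) (SMulMemClass.smul_mem _ (mem c c))
    · intro a b c hc
      have hcb : lieCrossEff f c b = 0 := by
        rw [lieCrossEff_comm, lieCrossEff, add_comm_right b c hc]
        abel
      rw [add_left, hcb, add_zero]
    · intro a
      simp
  · rintro ⟨g, h, g_mem, h_symm, h_add, h_mem, h_comm, hf⟩
    have cross := lieCrossEff_add_half_diagonal f g h h_symm h_add hf
    refine ⟨?_, ?_, ?_, ?_, ?_⟩
    · intro a a' b
      simp only [cross, h_add]
    · intro a b b'
      simp only [cross, h_symm a, h_add]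
    · intro a b
      rw [cross]
      exact h_mem a b
    · intro a c hc
      have hca : h c a = 0 := by simpa [h_add] using h_comm a a c hc
      have hac := cross a c
      rw [h_symm, hca, lieCrossEff, sub_sub, sub_eq_zero] at hac
      exact hac
    · intro c hc
      rw [hf]
      exact add_mem (g_mem c hc) (SMulMemClass.smul_mem _ (h_mem c c))
end
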